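/- Let f : R → S be a ring homomorphism and let s : P → Q be an R-linear map between finitely generated projective left R-modules, with R-dual s* : Q* → P* where M* = Hom_R(M, R) carries its natural right R-module structure ((g·r)(x) = g(x)·r) and s*(g) = g ∘ s. Then 1 ⊗ s : S ⊗_R P → S ⊗_R Q is bijective if and only if s* ⊗ 1 : Q* ⊗_R S → P* ⊗_R S is bijective (in the latter, S is regarded as a left R-module via f). Consequently, f is σ-inverting if and only if it is σ*-inverting, where σ* = { s* : s ∈ σ } is the set of R-dual maps between the (finitely generated projective) dual right R-modules. -/

import Mathlib

open MulOpposite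

universe u

section BTensorCore

variable (R : Type u) [Ring R]
variable (M : Type u) [AddCommGroup M] [Module Rᵐᵒᵖ M]
variable (N : Type u) [AddCommGroup N] [Module R N]

/-- The subgroup of relations defining the balanced tensor product `M ⊗_R N`. -/
noncomputable def btRel : AddSubgroup (TensorProduct ℤ M N) :=
  AddSubgroup.closure
    { x | ∃ (m : M) (r : R) (n : N), x = (op r • m) ⊗ₜ[ℤ] n - m ⊗ₜ[ℤ] (r • n) }

/-- The balanced tensor product `M ⊗_R N` of a right `R`-module `M` and a left `R`-module `N`:
the quotient of `M ⊗_ℤ N` by the relations `(m · r) ⊗ n = m ⊗ (r · n)`. -/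
abbrev BTensor : Type u := TensorProduct ℤ M N ⧸ btRel R M N

variable {R M N}

/-- The image of `m ⊗ n` in `M ⊗_R N`. -/
noncomputable def BTensor.tmul (m : M) (n : N) : BTensor R M N :=
  QuotientAddGroup.mk (m ⊗ₜ[ℤ] n)

variable {A : Type u} [AddCommGroup A]

/-- Lift a balanced biadditive map `M → N → A` to `M ⊗_R N → A`. -/
noncomputable def BTensor.lift (b : M →+ N →+ A)
    (hb : ∀ (r : R) (m : M) (n : N), b (op r • m) n = b m (r • n)) :
    BTensor R M N →+ A :=
  QuotientAddGroup.lift (btRel R M N)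
    (TensorProduct.liftAddHom b (fun z m n => by
      simp [map_zsmul]))
    ((AddSubgroup.closure_le _).mpr (by
      rintro y ⟨m, r, n, rfl⟩
      simp [AddMonoidHom.mem_ker, hb r m n]))

/-- Lift a balanced biadditive map given as a bare function. -/
noncomputable def BTensor.lift' (b : M → N → A)
    (h1 : ∀ m m' n, b (m + m') n = b m n + b m' n)
    (h2 : ∀ m n n', b m (n + n') = b m n + b m n')
    (hb : ∀ (r : R) m n, b (op r • m) n = b m (r • n)) :
    BTensor R M N →+ A :=
  BTensor.lift (AddMonoidHom.mk' (fun m => AddMonoidHom.mk' (b m) (h2 m))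
    (fun m m' => AddMonoidHom.ext fun n => h1 m m' n)) hb

section MapRight

variable {N' : Type u} [AddCommGroup N'] [Module R N']

/-- The map `1 ⊗ g : M ⊗_R N → M ⊗_R N'` induced by a map `g` of left `R`-modules. -/
noncomputable def BTensor.mapRight (g : N →ₗ[R] N') : BTensor R M N →+ BTensor R M N' :=
  QuotientAddGroup.map _ _
    (TensorProduct.map (LinearMap.id (R := ℤ) (M := M)) g.toAddMonoidHom.toIntLinearMap).toAddMonoidHom
    ((AddSubgroup.closure_le _).mpr (by
      rintro y ⟨m, r, n, rfl⟩
      refine AddSubgroup.mem_comap.mpr (AddSubgroup.subset_closure ?_)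
      exact ⟨m, r, g n, by simp⟩))

end MapRight

section MapLeft

variable {M' : Type u} [AddCommGroup M'] [Module Rᵐᵒᵖ M']

/-- The map `g ⊗ 1 : M ⊗_R N → M' ⊗_R N` induced by a map `g` of right `R`-modules. -/
noncomputable def BTensor.mapLeft (g : M →ₗ[Rᵐᵒᵖ] M') : BTensor R M N →+ BTensor R M' N :=
  QuotientAddGroup.map _ _
    (TensorProduct.map g.toAddMonoidHom.toIntLinearMap (LinearMap.id (R := ℤ) (M := N))).toAddMonoidHom
    ((AddSubgroup.closure_le _).mpr (by
      rintro y ⟨m, r, n, rfl⟩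
      refine AddSubgroup.mem_comap.mpr (AddSubgroup.subset_closure ?_)
      exact ⟨g m, r, n, by simp⟩))

end MapLeft

end BTensorCore

section Duality

variable {R : Type u} [Ring R]

/-- The `R`-dual `s* : Q* → P*` of a map `s : P → Q` of left `R`-modules, where
`M* = Hom_R(M, R)` carries its natural right `R`-module structure `(g · r) (x) = g x * r`,
and `s* g = g ∘ s`. -/
def dualTranspose {P Q : Type u} [AddCommGroup P] [Module R P] [AddCommGroup Q] [Module R Q]
    (s : P →ₗ[R] Q) : (Q →ₗ[R] R) →ₗ[Rᵐᵒᵖ] (P →ₗ[R] R) where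
  toFun g := g.comp s
  map_add' g g' := LinearMap.add_comp _ _ _
  map_smul' c g := by ext x; rfl

namespace BTensor

section Basic

variable {M M' N N' A : Type u} [AddCommGroup M] [Module Rᵐᵒᵖ M] [AddCommGroup M']
  [Module Rᵐᵒᵖ M'] [AddCommGroup N] [Module R N] [AddCommGroup N'] [Module R N']
  [AddCommGroup A]

@[elab_as_elim]
theorem induction_on {C : BTensor R M N → Prop} (z : BTensor R M N)
    (tmul : ∀ m n, C (tmul m n)) (add : ∀ x y, C x → C y → C (x + y)) : C z := by
  obtain ⟨z, rfl⟩ := QuotientAddGroup.mk_surjective z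
  induction z using TensorProduct.induction_on with
  | zero => simpa [BTensor.tmul] using tmul 0 0
  | tmul m n => exact tmul m n
  | add x y hx hy => exact add _ _ hx hy

theorem addHom_ext {g g' : BTensor R M N →+ A} (h : ∀ m n, g (tmul m n) = g' (tmul m n)) :
    g = g' := by
  refine AddMonoidHom.ext fun z => ?_
  induction z using BTensor.induction_on with
  | tmul m n => exact h m n
  | add x y hx hy => rw [map_add, map_add, hx, hy]

theorem add_tmul (m m' : M) (n : N) :
    tmul (R := R) (m + m') n = tmul m n + tmul m' n :=
  congrArg QuotientAddGroup.mk (TensorProduct.add_tmul m m' n)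

theorem tmul_add (m : M) (n n' : N) :
    tmul (R := R) m (n + n') = tmul m n + tmul m n' :=
  congrArg QuotientAddGroup.mk (TensorProduct.tmul_add m n n')

theorem smul_tmul (r : R) (m : M) (n : N) : tmul (R := R) (op r • m) n = tmul m (r • n) :=
  QuotientAddGroup.eq_iff_sub_mem.mpr (AddSubgroup.subset_closure ⟨m, r, n, rfl⟩)

theorem sum_tmul {κ : Type*} (s : Finset κ) (m : κ → M) (n : N) :
    tmul (R := R) (∑ k ∈ s, m k) n = ∑ k ∈ s, tmul (m k) n :=
  map_sum (AddMonoidHom.mk' (fun m => tmul (R := R) m n) fun m m' => add_tmul m m' n) m s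

theorem tmul_sum {κ : Type*} (s : Finset κ) (m : M) (n : κ → N) :
    tmul (R := R) m (∑ k ∈ s, n k) = ∑ k ∈ s, tmul m (n k) :=
  map_sum (AddMonoidHom.mk' (fun n => tmul (R := R) m n) fun n n' => tmul_add m n n') n s

theorem mapRight_tmul (g : N →ₗ[R] N') (m : M) (n : N) :
    mapRight g (tmul m n) = tmul m (g n) := rfl

theorem mapLeft_tmul (g : M →ₗ[Rᵐᵒᵖ] M') (m : M) (n : N) :
    mapLeft g (tmul m n) = tmul (g m) n := rfl

theorem lift'_tmul (b : M → N → A) (h1 h2 hb) (m : M) (n : N) :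
    lift' (R := R) b h1 h2 hb (tmul m n) = b m n := rfl

theorem mapLeft_mapRight (g : M →ₗ[Rᵐᵒᵖ] M') (g' : N →ₗ[R] N') (z : BTensor R M N) :
    mapLeft g (mapRight g' z) = mapRight g' (mapLeft g z) := by
  induction z using BTensor.induction_on with
  | tmul m n => rfl
  | add x y hx hy => simp only [map_add, hx, hy]

end Basic

section Pairing

variable {P Q S : Type u} [AddCommGroup P] [Module R P] [AddCommGroup Q] [Module R Q]
  [Ring S] [Module Rᵐᵒᵖ S] [Module R S]
  (hS : ∀ (r : R) (b a : S), (op r • b) * a = b * (r • a))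

include hS

/-- Left multiplication by `c : S`, as a map of right `R`-modules. -/
def mulLeftHom (c : S) : S →ₗ[Rᵐᵒᵖ] S where
  toFun b := c * b
  map_add' := mul_add c
  map_smul' r b := by
    have h (b : S) : r • b = b * (r.unop • 1) := by simpa using hS r.unop b 1
    rw [RingHom.id_apply, h b, h (c * b), mul_assoc]

/-- Right multiplication by `c : S`, as a map of left `R`-modules. -/
def mulRightHom (c : S) : S →ₗ[R] S where
  toFun a := a * c
  map_add' a a' := add_mul a a' c
  map_smul' r a := by
    have h (a : S) : r • a = (op r • 1) * a := by simpa using (hS r 1 a).symm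
    rw [h, RingHom.id_apply, h, mul_assoc]

/-- The pairing `⟨φ ⊗ a, b ⊗ x⟩ = b * φ x * a` between `P* ⊗_R S` and `S ⊗_R P`. -/
noncomputable def dualPairing : BTensor R (P →ₗ[R] R) S →+ BTensor R S P →+ S :=
  lift' (fun φ a => lift' (fun b x => b * (φ x • a))
      (fun b b' x => add_mul b b' _)
      (fun b x x' => by rw [map_add, add_smul, mul_add])
      (fun r b x => by rw [hS, map_smul, smul_smul, smul_eq_mul]))
    (fun φ φ' a => addHom_ext fun b x => by
      simp only [AddMonoidHom.add_apply, lift'_tmul, LinearMap.add_apply, add_smul, mul_add])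
    (fun φ a a' => addHom_ext fun b x => by
      simp only [AddMonoidHom.add_apply, lift'_tmul, smul_add, mul_add])
    (fun r φ a => addHom_ext fun b x => by
      simp only [lift'_tmul]
      rw [LinearMap.smul_apply, op_smul_eq_mul, mul_smul])

theorem dualPairing_tmul_tmul (φ : P →ₗ[R] R) (a b : S) (x : P) :
    dualPairing hS (tmul φ a) (tmul b x) = b * (φ x • a) := rfl

theorem dualPairing_mulLeft (c : S) (η : BTensor R (P →ₗ[R] R) S) (ξ : BTensor R S P) :
    dualPairing hS η (mapLeft (mulLeftHom hS c) ξ) = c * dualPairing hS η ξ := by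
  induction ξ using BTensor.induction_on with
  | add x y hx hy => simp only [map_add, hx, hy, mul_add]
  | tmul b x =>
    induction η using BTensor.induction_on with
    | add x y hx hy => simp only [map_add, AddMonoidHom.add_apply, hx, hy, mul_add]
    | tmul φ a => exact mul_assoc c b _

theorem dualPairing_mulRight (c : S) (η : BTensor R (P →ₗ[R] R) S) (ξ : BTensor R S P) :
    dualPairing hS (mapRight (mulRightHom hS c) η) ξ = dualPairing hS η ξ * c := by
  induction ξ using BTensor.induction_on with
  | add x y hx hy => simp only [map_add, hx, hy, add_mul]
  | tmul b x =>
    induction η using BTensor.induction_on with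
    | add x y hx hy => simp only [map_add, AddMonoidHom.add_apply, hx, hy, add_mul]
    | tmul φ a =>
      rw [mapRight_tmul, dualPairing_tmul_tmul, dualPairing_tmul_tmul,
        ← map_smul (mulRightHom hS c)]
      exact (mul_assoc b _ c).symm

theorem dualPairing_dualTranspose (s : P →ₗ[R] Q) (η : BTensor R (Q →ₗ[R] R) S)
    (ξ : BTensor R S P) :
    dualPairing hS (mapLeft (dualTranspose s) η) ξ = dualPairing hS η (mapRight s ξ) := by
  induction ξ using BTensor.induction_on with
  | add x y hx hy => simp only [map_add, hx, hy]
  | tmul b x =>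
    induction η using BTensor.induction_on with
    | add x y hx hy => simp only [map_add, AddMonoidHom.add_apply, hx, hy]
    | tmul φ a => rfl

section DualBasis

variable {κ : Type*} [Fintype κ] {x : κ → P} {φ : κ → P →ₗ[R] R}
  (hx : ∀ p, ∑ k, φ k p • x k = p)

include hx

theorem sum_dualPairing_tmul (ξ : BTensor R S P) :
    ∑ k, tmul (dualPairing hS (tmul (φ k) 1) ξ) (x k) = ξ := by
  induction ξ using BTensor.induction_on with
  | add y z hy hz => simp only [map_add, add_tmul, Finset.sum_add_distrib, hy, hz]
  | tmul b p =>
    conv_rhs => rw [← hx p, tmul_sum]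
    refine Finset.sum_congr rfl fun k _ => ?_
    rw [dualPairing_tmul_tmul, ← hS, mul_one, smul_tmul]

theorem sum_tmul_dualPairing (η : BTensor R (P →ₗ[R] R) S) :
    ∑ k, tmul (φ k) (dualPairing hS η (tmul 1 (x k))) = η := by
  induction η using BTensor.induction_on with
  | add y z hy hz =>
    simp only [map_add, AddMonoidHom.add_apply, tmul_add, Finset.sum_add_distrib, hy, hz]
  | tmul ψ a =>
    have h : ∑ k, op (ψ (x k)) • φ k = ψ := by
      ext p
      conv_rhs => rw [← hx p]
      simp
    conv_rhs => rw [← h, sum_tmul]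
    refine Finset.sum_congr rfl fun k _ => ?_
    rw [dualPairing_tmul_tmul, one_mul, smul_tmul]

theorem eq_of_dualPairing_right {η η' : BTensor R (P →ₗ[R] R) S}
    (h : ∀ ξ, dualPairing hS η ξ = dualPairing hS η' ξ) : η = η' := by
  rw [← sum_tmul_dualPairing hS hx η, ← sum_tmul_dualPairing hS hx η']
  simp only [h]

theorem eq_of_dualPairing_left {ξ ξ' : BTensor R S P}
    (h : ∀ η, dualPairing hS η ξ = dualPairing hS η ξ') : ξ = ξ' := by
  rw [← sum_dualPairing_tmul hS hx ξ, ← sum_dualPairing_tmul hS hx ξ']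
  simp only [h]

end DualBasis

variable {κ μ : Type*} [Fintype κ] [Fintype μ] {x : κ → P} {φ : κ → P →ₗ[R] R}
  {y : μ → Q} {ψ : μ → Q →ₗ[R] R}

theorem bijective_mapLeft_dualTranspose
    (hx : ∀ p, ∑ k, φ k p • x k = p) (hy : ∀ q, ∑ k, ψ k q • y k = q)
    {s : P →ₗ[R] Q} (hs : Function.Bijective (mapRight (M := S) s)) :
    Function.Bijective (mapLeft (N := S) (dualTranspose s)) := by
  refine ⟨fun η η' h => eq_of_dualPairing_right hS hy fun ζ => ?_, fun η => ?_⟩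
  · obtain ⟨ξ, rfl⟩ := hs.2 ζ
    rw [← dualPairing_dualTranspose, ← dualPairing_dualTranspose, h]
  · choose t ht using fun k => hs.2 (tmul 1 (y k))
    refine ⟨∑ k, tmul (ψ k) (dualPairing hS η (t k)),
      eq_of_dualPairing_right hS hx fun ξ => ?_⟩
    have hξ : ∑ k, mapLeft (mulLeftHom hS (dualPairing hS (tmul (ψ k) 1) (mapRight s ξ))) (t k)
        = ξ := by
      apply hs.1
      conv_rhs => rw [← sum_dualPairing_tmul hS hy (mapRight s ξ)]
      rw [map_sum]
      refine Finset.sum_congr rfl fun k _ => ?_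
      rw [← mapLeft_mapRight, ht, mapLeft_tmul]
      exact congrArg (tmul · (y k)) (mul_one _)
    conv_rhs => rw [← hξ]
    rw [dualPairing_dualTranspose, map_sum, map_sum, AddMonoidHom.finsetSum_apply]
    refine Finset.sum_congr rfl fun k _ => ?_
    rw [dualPairing_mulLeft, ← dualPairing_mulRight, mapRight_tmul]
    exact congrArg (fun a => dualPairing hS (tmul (ψ k) a) _) (one_mul _).symm

theorem bijective_mapRight_of_dualTranspose
    (hx : ∀ p, ∑ k, φ k p • x k = p) (hy : ∀ q, ∑ k, ψ k q • y k = q)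
    {s : P →ₗ[R] Q} (hs : Function.Bijective (mapLeft (N := S) (dualTranspose s))) :
    Function.Bijective (mapRight (M := S) s) := by
  refine ⟨fun ξ ξ' h => eq_of_dualPairing_left hS hx fun η => ?_, fun ζ => ?_⟩
  · obtain ⟨η, rfl⟩ := hs.2 η
    rw [dualPairing_dualTranspose, dualPairing_dualTranspose, h]
  · choose t ht using fun k => hs.2 (tmul (φ k) 1)
    refine ⟨∑ k, tmul (dualPairing hS (t k) ζ) (x k),
      eq_of_dualPairing_left hS hy fun η => ?_⟩
    have hη : ∑ k, mapRight
        (mulRightHom hS (dualPairing hS (mapLeft (dualTranspose s) η) (tmul 1 (x k)))) (t k)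
        = η := by
      apply hs.1
      conv_rhs => rw [← sum_tmul_dualPairing hS hx (mapLeft (dualTranspose s) η)]
      rw [map_sum]
      refine Finset.sum_congr rfl fun k _ => ?_
      rw [mapLeft_mapRight, ht, mapRight_tmul]
      exact congrArg (tmul (φ k)) (one_mul _)
    conv_rhs => rw [← hη]
    rw [← dualPairing_dualTranspose, map_sum, map_sum, AddMonoidHom.finsetSum_apply]
    refine Finset.sum_congr rfl fun k _ => ?_
    rw [dualPairing_mulRight, ← dualPairing_mulLeft, mapLeft_tmul]
    exact congrArg (fun a => dualPairing hS _ (tmul a (x k))) (mul_one _).symm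

end Pairing

end BTensor

theorem Module.Projective.exists_finite_dual_basis (P : Type*) [AddCommGroup P] [Module R P]
    [Module.Finite R P] [Module.Projective R P] :
    ∃ (n : ℕ) (x : Fin n → P) (φ : Fin n → P →ₗ[R] R), ∀ p, ∑ k, φ k p • x k = p := by
  obtain ⟨n, g, i, -, -, h⟩ := Module.Finite.exists_comp_eq_id_of_projective R P
  refine ⟨n, fun k => g (Pi.single k 1), fun k => LinearMap.proj k ∘ₗ i, fun p => ?_⟩
  conv_rhs => rw [← LinearMap.id_apply (R := R) p, ← h, LinearMap.comp_apply,
    pi_eq_sum_univ' (i p), map_sum]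
  refine Finset.sum_congr rfl fun k _ => ?_
  rw [map_smul]
  congr 2

variable {ι : Type u} {P Q : ι → Type u}
  [∀ i, AddCommGroup (P i)] [∀ i, Module R (P i)]
  [∀ i, AddCommGroup (Q i)] [∀ i, Module R (Q i)]

/-- For a ring homomorphism `f : R → S` and `s : P → Q` a map of finitely generated projective
left `R`-modules: `1 ⊗ s : S ⊗_R P → S ⊗_R Q` is bijective if and only if
`s* ⊗ 1 : Q* ⊗_R S → P* ⊗_R S` is bijective. Consequently `f` is `σ`-inverting if and only if
it is `σ*`-inverting. -/
theorem bijective_mapRight_iff_bijective_dual_mapLeft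
    (s : ∀ i, P i →ₗ[R] Q i)
    (hPfin : ∀ i, Module.Finite R (P i)) (hPproj : ∀ i, Module.Projective R (P i))
    (hQfin : ∀ i, Module.Finite R (Q i)) (hQproj : ∀ i, Module.Projective R (Q i))
    (S : Type u) [Ring S] [Module Rᵐᵒᵖ S] [Module R S] (f : R →+* S)
    (hright : ∀ (r : R) (x : S), op r • x = x * f r)
    (hleft : ∀ (r : R) (x : S), r • x = f r * x) :
    (∀ i, Function.Bijective (BTensor.mapRight (M := S) (s i)) ↔
        Function.Bijective (BTensor.mapLeft (N := S) (dualTranspose (s i)))) ∧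
    ((∀ i, Function.Bijective (BTensor.mapRight (M := S) (s i))) ↔
      (∀ i, Function.Bijective (BTensor.mapLeft (N := S) (dualTranspose (s i))))) := by
  have hS (r : R) (b a : S) : (op r • b) * a = b * (r • a) := by
    rw [hright, hleft, mul_assoc]
  have key (i : ι) : Function.Bijective (BTensor.mapRight (M := S) (s i)) ↔
      Function.Bijective (BTensor.mapLeft (N := S) (dualTranspose (s i))) := by
    have := hPfin i
    have := hPproj i
    have := hQfin i
    have := hQproj i
    obtain ⟨m, x, φ, hx⟩ := Module.Projective.exists_finite_dual_basis (R := R) (P i)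
    obtain ⟨n, y, ψ, hy⟩ := Module.Projective.exists_finite_dual_basis (R := R) (Q i)
    exact ⟨BTensor.bijective_mapLeft_dualTranspose hS hx hy,
      BTensor.bijective_mapRight_of_dualTranspose hS hx hy⟩
  exact ⟨key, forall_congr' key⟩

end Duality
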